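/- There exists a unique pair (c, s) of holomorphic functions on the open disc B_{2r}(0) of radius 2r = 2^(1/3) about 0 satisfying the initial value problem IVP: c(0) = 1, s(0) = 0, and for every z in B_{2r}(0), c'(z) = -s(z)^2 and s'(z) = c(z)^2. -/

import Mathlib

open Complex Metric Set

mutual

/-- The coefficient of `z ^ (3 * k)` in the Dixon function `cm`. -/
noncomputable def cmCoeff : ℕ → ℂ
  | 0 => 1
  | k + 1 => -(∑ i : Fin (k + 1), smCoeff i * smCoeff (k - i)) / (3 * (k + 1))
termination_by k => 2 * k
decreasing_by all_goals have := i.isLt; omega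

/-- The coefficient of `z ^ (3 * k + 1)` in the Dixon function `sm`. -/
noncomputable def smCoeff : ℕ → ℂ
  | k => (∑ i : Fin (k + 1), cmCoeff i * cmCoeff (k - i)) / (3 * k + 1)
termination_by k => 2 * k + 1
decreasing_by all_goals have := i.isLt; omega

end

lemma cmCoeff_zero : cmCoeff 0 = 1 := by rw [cmCoeff]

lemma sum_antidiagonal_smCoeff (k : ℕ) :
    ∑ p ∈ Finset.HasAntidiagonal.antidiagonal k, smCoeff p.1 * smCoeff p.2 = -(3 * (k + 1) * cmCoeff (k + 1)) := by
  have h : (k : ℂ) + 1 ≠ 0 := by exact_mod_cast k.succ_ne_zero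
  rw [cmCoeff, Finset.Nat.sum_antidiagonal_eq_sum_range_succ (fun i j => smCoeff i * smCoeff j),
    Finset.sum_range]
  field_simp

lemma sum_antidiagonal_cmCoeff (k : ℕ) :
    ∑ p ∈ Finset.HasAntidiagonal.antidiagonal k, cmCoeff p.1 * cmCoeff p.2 = (3 * k + 1) * smCoeff k := by
  have h : 3 * (k : ℂ) + 1 ≠ 0 := by exact_mod_cast (3 * k).succ_ne_zero
  rw [smCoeff, Finset.Nat.sum_antidiagonal_eq_sum_range_succ (fun i j => cmCoeff i * cmCoeff j),
    Finset.sum_range]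
  field_simp

lemma norm_sum_antidiagonal_le {a : ℕ → ℂ} {q : ℝ} {k : ℕ} (ha : ∀ i ≤ k, ‖a i‖ ≤ q ^ i) :
    ‖∑ p ∈ Finset.HasAntidiagonal.antidiagonal k, a p.1 * a p.2‖ ≤ (k + 1) * q ^ k := by
  calc ‖∑ p ∈ Finset.HasAntidiagonal.antidiagonal k, a p.1 * a p.2‖
      ≤ ∑ p ∈ Finset.HasAntidiagonal.antidiagonal k, q ^ k := by
        refine norm_sum_le_of_le _ fun p hp => ?_
        rw [Finset.HasAntidiagonal.mem_antidiagonal] at hp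
        rw [norm_mul, ← hp, pow_add]
        have h := ha p.1 (by omega)
        exact mul_le_mul h (ha p.2 (by omega)) (norm_nonneg _) ((norm_nonneg _).trans h)
    _ = (k + 1) * q ^ k := by simp

lemma norm_smCoeff_le_of_norm_cmCoeff_le {q : ℝ} {k : ℕ} (hq : 0 ≤ q)
    (h : ∀ i ≤ k, ‖cmCoeff i‖ ≤ q ^ i) : ‖smCoeff k‖ ≤ q ^ k := by
  have h1 := norm_sum_antidiagonal_le h
  have h2 : ‖3 * (k : ℂ) + 1‖ = 3 * k + 1 := by
    exact_mod_cast Complex.norm_natCast (3 * k + 1)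
  rw [sum_antidiagonal_cmCoeff, norm_mul, h2] at h1
  have h3 : (0 : ℝ) < 3 * k + 1 := by positivity
  refine le_of_mul_le_mul_left (h1.trans ?_) h3
  gcongr
  linarith [(Nat.cast_nonneg k : (0 : ℝ) ≤ k)]

lemma norm_cmCoeff_le (k : ℕ) : ‖cmCoeff k‖ ≤ (1 / 2) ^ k := by
  induction k using Nat.strong_induction_on with
  | _ k ih =>
    cases k with
    | zero => simp [cmCoeff_zero]
    | succ k =>
      have h1 := norm_sum_antidiagonal_le (a := smCoeff) (q := 1 / 2) (k := k) fun i hi =>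
        norm_smCoeff_le_of_norm_cmCoeff_le (by norm_num) fun j hj => ih j (by omega)
      have h2 : ‖(k : ℂ) + 1‖ = k + 1 := by exact_mod_cast Complex.norm_natCast (k + 1)
      rw [sum_antidiagonal_smCoeff, norm_neg, norm_mul, norm_mul, h2, Complex.norm_ofNat] at h1
      have h3 : (0 : ℝ) < k + 1 := by positivity
      have h4 : 3 * ‖cmCoeff (k + 1)‖ ≤ (1 / 2) ^ k :=
        le_of_mul_le_mul_left (by linarith) h3
      have h5 : (0 : ℝ) < (1 / 2) ^ k := by positivity
      rw [pow_succ]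
      linarith

lemma norm_smCoeff_le (k : ℕ) : ‖smCoeff k‖ ≤ (1 / 2) ^ k :=
  norm_smCoeff_le_of_norm_cmCoeff_le (by norm_num) fun i _ => norm_cmCoeff_le i

lemma summable_norm_mul_pow {a : ℕ → ℂ} (ha : ∀ k, ‖a k‖ ≤ (1 / 2) ^ k) {w : ℂ} (hw : ‖w‖ < 2) :
    Summable fun k => ‖a k * w ^ k‖ := by
  refine Summable.of_nonneg_of_le (fun _ => norm_nonneg _) (fun k => ?_)
    (summable_geometric_of_lt_one (r := ‖w‖ / 2) (by positivity) (by linarith))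
  rw [norm_mul, norm_pow, div_eq_inv_mul, mul_pow, ← one_div]
  gcongr
  exact ha k

lemma norm_mul_natCast_mul_pow_le {x y : ℂ} {k : ℕ} {ρ : ℝ} (hx : ‖x‖ ≤ (1 / 2) ^ k)
    (hρ : 0 < ρ) (hy : ‖y‖ ≤ ρ) :
    ‖x * (k * y ^ (k - 1))‖ ≤ (k : ℝ) ^ 1 * (ρ / 2) ^ k * ρ⁻¹ := by
  rcases k with _ | k
  · simp
  · calc ‖x * ((k + 1 : ℕ) * y ^ (k + 1 - 1))‖
        = ‖x‖ * ((k + 1 : ℕ) * ‖y‖ ^ k) := by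
          rw [norm_mul, norm_mul, norm_pow, Complex.norm_natCast, Nat.add_sub_cancel]
      _ ≤ (1 / 2) ^ (k + 1) * ((k + 1 : ℕ) * ρ ^ k) := by gcongr
      _ = ((k + 1 : ℕ) : ℝ) ^ 1 * (ρ / 2) ^ (k + 1) * ρ⁻¹ := by
          rw [div_pow, div_pow, one_pow, pow_one, pow_succ ρ]
          field_simp

/-- A power series may be differentiated term by term. -/
lemma hasDerivAt_tsum_mul_pow {a : ℕ → ℂ} (ha : ∀ k, ‖a k‖ ≤ (1 / 2) ^ k) {w : ℂ}
    (hw : ‖w‖ < 2) :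
    HasDerivAt (fun w => ∑' k, a k * w ^ k) (∑' k : ℕ, a k * (k * w ^ (k - 1))) w ∧
      Summable fun k : ℕ => a k * (k * w ^ (k - 1)) := by
  obtain ⟨ρ, hwρ, hρ⟩ := exists_between hw
  have hρ0 : 0 < ρ := (norm_nonneg w).trans_lt hwρ
  have hρ2 : ‖ρ / 2‖ < 1 := by
    rw [Real.norm_of_nonneg (by positivity)]
    linarith
  have hu : Summable fun k : ℕ => (k : ℝ) ^ 1 * (ρ / 2) ^ k * ρ⁻¹ :=
    (summable_pow_mul_geometric_of_norm_lt_one 1 hρ2).mul_right _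
  have hb : ∀ k : ℕ, ∀ y ∈ ball (0 : ℂ) ρ, ‖a k * (k * y ^ (k - 1))‖ ≤
      (k : ℝ) ^ 1 * (ρ / 2) ^ k * ρ⁻¹ := fun k y hy =>
    norm_mul_natCast_mul_pow_le (ha k) hρ0 (mem_ball_zero_iff.1 hy).le
  have hmem : w ∈ ball (0 : ℂ) ρ := mem_ball_zero_iff.2 hwρ
  have hs : Summable fun k : ℕ => a k * (k * w ^ (k - 1)) :=
    Summable.of_norm_bounded hu fun k => hb k w hmem
  have hd := hasDerivAt_tsum_of_isPreconnected (g := fun k y => a k * y ^ k)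
    (g' := fun k y => a k * (k * y ^ (k - 1))) hu isOpen_ball (convex_ball _ _).isPreconnected
    (fun k y _ => (hasDerivAt_pow k y).const_mul (a k)) hb hmem
    (summable_norm_mul_pow ha hw).of_norm hmem
  exact ⟨hd, hs⟩

lemma tsum_mul_pow_sq {a : ℕ → ℂ} (ha : ∀ k, ‖a k‖ ≤ (1 / 2) ^ k) {w : ℂ} (hw : ‖w‖ < 2) :
    (∑' k, a k * w ^ k) ^ 2 =
      ∑' k, (∑ p ∈ Finset.HasAntidiagonal.antidiagonal k, a p.1 * a p.2) * w ^ k := by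
  have h := summable_norm_mul_pow ha hw
  rw [sq, tsum_mul_tsum_eq_tsum_sum_antidiagonal_of_summable_norm h h]
  refine tsum_congr fun k => ?_
  rw [Finset.sum_mul]
  refine Finset.sum_congr rfl fun p hp => ?_
  rw [Finset.HasAntidiagonal.mem_antidiagonal] at hp
  rw [← hp]
  ring

lemma hasDerivAt_tsum_cmCoeff {z : ℂ} (hz : ‖z ^ 3‖ < 2) :
    HasDerivAt (fun z => ∑' k, cmCoeff k * (z ^ 3) ^ k)
      (-(z * ∑' k, smCoeff k * (z ^ 3) ^ k) ^ 2) z := by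
  obtain ⟨hd, hs⟩ := hasDerivAt_tsum_mul_pow norm_cmCoeff_le hz
  refine (hd.comp z (hasDerivAt_pow 3 z)).congr_deriv ?_
  rw [mul_pow, tsum_mul_pow_sq norm_smCoeff_le hz, hs.tsum_eq_zero_add]
  simp only [sum_antidiagonal_smCoeff]
  rw [← tsum_mul_left, ← neg_one_mul, ← tsum_mul_left, Nat.cast_zero, zero_mul, mul_zero, zero_add,
    ← tsum_mul_right]
  refine tsum_congr fun k => ?_
  push_cast
  ring

lemma hasDerivAt_mul_tsum_smCoeff {z : ℂ} (hz : ‖z ^ 3‖ < 2) :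
    HasDerivAt (fun z => z * ∑' k, smCoeff k * (z ^ 3) ^ k)
      ((∑' k, cmCoeff k * (z ^ 3) ^ k) ^ 2) z := by
  obtain ⟨hd, hs⟩ := hasDerivAt_tsum_mul_pow norm_smCoeff_le hz
  refine ((hasDerivAt_id z).mul (hd.comp z (hasDerivAt_pow 3 z))).congr_deriv ?_
  rw [tsum_mul_pow_sq norm_cmCoeff_le hz]
  simp only [sum_antidiagonal_cmCoeff, Function.comp_apply, id, one_mul]
  rw [← tsum_mul_right, ← tsum_mul_left,
    ← (summable_norm_mul_pow norm_smCoeff_le hz).of_norm.tsum_add ((hs.mul_right _).mul_left _)]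
  refine tsum_congr fun k => ?_
  rcases k with _ | k
  · simp
  · push_cast
    ring

/-- Two solutions of the initial value problem on a disc about `0` agree there. -/
lemma eq_of_hasDerivAt_neg_sq_sq {R : ℝ} {c s C S : ℂ → ℂ} (hc0 : C 0 = c 0) (hs0 : S 0 = s 0)
    (h : ∀ z ∈ ball (0 : ℂ) R, HasDerivAt c (-(s z) ^ 2) z ∧ HasDerivAt s ((c z) ^ 2) z)
    (H : ∀ z ∈ ball (0 : ℂ) R, HasDerivAt C (-(S z) ^ 2) z ∧ HasDerivAt S ((C z) ^ 2) z)
    {z : ℂ} (hz : z ∈ ball (0 : ℂ) R) : C z = c z ∧ S z = s z := by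
  have hmem : ∀ t ∈ Icc (0 : ℝ) 1, (t : ℂ) * z ∈ ball (0 : ℂ) R := by
    intro t ht
    rw [mem_ball_zero_iff] at hz ⊢
    rw [norm_mul, Complex.norm_of_nonneg ht.1]
    exact (mul_le_of_le_one_left (norm_nonneg z) ht.2).trans_lt hz
  have key : ∀ {f : ℂ → ℂ} {f' : ℂ} {t : ℝ}, HasDerivAt f f' (t * z) →
      HasDerivAt (fun t : ℝ => f (t * z)) (f' * z) t := by
    intro f f' t hf
    have h1 : HasDerivAt (fun t : ℝ => (t : ℂ) * z) z t := by
      simpa using (Complex.ofRealCLM.hasDerivAt (x := t)).mul_const z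
    exact hf.comp t h1
  set f : ℝ → ℂ × ℂ := fun t => (C (t * z) - c (t * z), S (t * z) - s (t * z)) with hf
  set f' : ℝ → ℂ × ℂ := fun t =>
    (-(S (t * z)) ^ 2 * z - -(s (t * z)) ^ 2 * z, (C (t * z)) ^ 2 * z - (c (t * z)) ^ 2 * z)
  have hder : ∀ t ∈ Icc (0 : ℝ) 1, HasDerivAt f (f' t) t := fun t ht =>
    ((key (H _ (hmem t ht)).1).sub (key (h _ (hmem t ht)).1)).prodMk
      ((key (H _ (hmem t ht)).2).sub (key (h _ (hmem t ht)).2))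
  have hcont : ∀ {g g' : ℂ → ℂ}, (∀ z ∈ ball (0 : ℂ) R, HasDerivAt g (g' z) z) →
      ContinuousOn (fun t : ℝ => g (t * z)) (Icc 0 1) := fun hg t ht =>
    (key (hg _ (hmem t ht))).continuousAt.continuousWithinAt
  obtain ⟨K₁, hK₁⟩ := isCompact_Icc.exists_bound_of_continuousOn
    ((((hcont fun z hz => (H z hz).1).add (hcont fun z hz => (h z hz).1))).mul_const z)
  obtain ⟨K₂, hK₂⟩ := isCompact_Icc.exists_bound_of_continuousOn
    ((((hcont fun z hz => (H z hz).2).add (hcont fun z hz => (h z hz).2))).mul_const z)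
  have hbound : ∀ t ∈ Ico (0 : ℝ) 1, ‖f' t‖ ≤ max K₁ K₂ * ‖f t‖ := by
    intro t ht
    have ht' := Ico_subset_Icc_self ht
    refine norm_prod_le_iff.2 ⟨?_, ?_⟩
    · calc ‖-(S (t * z)) ^ 2 * z - -(s (t * z)) ^ 2 * z‖
          = ‖(S (t * z) + s (t * z)) * z‖ * ‖(f t).2‖ := by
            rw [← norm_mul, ← norm_neg]
            congr 1
            simp only [hf]
            ring
        _ ≤ max K₁ K₂ * ‖f t‖ :=
            mul_le_mul ((hK₂ t ht').trans (le_max_right _ _)) (norm_snd_le _) (norm_nonneg _)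
              ((norm_nonneg _).trans ((hK₂ t ht').trans (le_max_right _ _)))
    · calc ‖(C (t * z)) ^ 2 * z - (c (t * z)) ^ 2 * z‖
          = ‖(C (t * z) + c (t * z)) * z‖ * ‖(f t).1‖ := by
            rw [← norm_mul]
            congr 1
            simp only [hf]
            ring
        _ ≤ max K₁ K₂ * ‖f t‖ :=
            mul_le_mul ((hK₁ t ht').trans (le_max_left _ _)) (norm_fst_le _) (norm_nonneg _)
              ((norm_nonneg _).trans ((hK₁ t ht').trans (le_max_left _ _)))
  have hzero := eq_zero_of_abs_deriv_le_mul_abs_self_of_eq_zero_right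
    (fun t ht => (hder t ht).continuousAt.continuousWithinAt)
    (fun t ht => (hder t (Ico_subset_Icc_self ht)).hasDerivWithinAt)
    (by simp [hf, hc0, hs0]) hbound 1 (right_mem_Icc.2 zero_le_one)
  simpa [hf, sub_eq_zero] using hzero

lemma norm_pow_three_lt_two {r : ℝ} (hr : r = (2 : ℝ) ^ (-(2 / 3) : ℝ)) {z : ℂ}
    (hz : z ∈ ball (0 : ℂ) (2 * r)) : ‖z ^ 3‖ < 2 := by
  have hr3 : r ^ 3 = 1 / 4 := by
    rw [hr, ← Real.rpow_natCast, ← Real.rpow_mul zero_le_two]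
    norm_num [Real.rpow_neg]
  rw [mem_ball_zero_iff] at hz
  rw [norm_pow]
  calc ‖z‖ ^ 3 < (2 * r) ^ 3 := pow_lt_pow_left₀ hz (norm_nonneg z) three_ne_zero
    _ = 2 := by rw [mul_pow, hr3]; norm_num

/-- There exists a unique pair `(c, s)` of holomorphic functions on the
open disc `B_{2r}(0)` with `r = 2^(-2/3)` (so `2r = 2^(1/3)`) solving the IVP. -/
theorem dixon_IVP_existence_uniqueness_2r (r : ℝ) (hr : r = (2:ℝ) ^ (-(2/3) : ℝ)) :
    ∃ c s : ℂ → ℂ,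
      (c 0 = 1 ∧ s 0 = 0 ∧
        ∀ z ∈ Metric.ball (0:ℂ) (2 * r),
          HasDerivAt c (-(s z) ^ 2) z ∧ HasDerivAt s ((c z) ^ 2) z) ∧
      ∀ C S : ℂ → ℂ,
        (C 0 = 1 ∧ S 0 = 0 ∧
          ∀ z ∈ Metric.ball (0:ℂ) (2 * r),
            HasDerivAt C (-(S z) ^ 2) z ∧ HasDerivAt S ((C z) ^ 2) z) →
        Set.EqOn C c (Metric.ball (0:ℂ) (2 * r)) ∧
        Set.EqOn S s (Metric.ball (0:ℂ) (2 * r)) := by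
  have h : ∀ z ∈ ball (0 : ℂ) (2 * r), _ := fun z hz =>
    And.intro (hasDerivAt_tsum_cmCoeff (norm_pow_three_lt_two hr hz))
      (hasDerivAt_mul_tsum_smCoeff (norm_pow_three_lt_two hr hz))
  have hc0 : ∑' k, cmCoeff k * ((0 : ℂ) ^ 3) ^ k = 1 := by
    rw [tsum_eq_single 0 fun k hk => by simp [hk]]
    simp [cmCoeff_zero]
  have hs0 : 0 * ∑' k, smCoeff k * ((0 : ℂ) ^ 3) ^ k = 0 := zero_mul _
  refine ⟨fun z => ∑' k, cmCoeff k * (z ^ 3) ^ k, fun z => z * ∑' k, smCoeff k * (z ^ 3) ^ k,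
    ⟨hc0, hs0, h⟩, fun C S ⟨hC0, hS0, H⟩ => ?_⟩
  have heq : ∀ z ∈ ball (0 : ℂ) (2 * r), _ := fun z hz =>
    eq_of_hasDerivAt_neg_sq_sq (s := fun z => z * ∑' k, smCoeff k * (z ^ 3) ^ k)
      (hC0.trans hc0.symm) (hS0.trans hs0.symm) h H hz
  exact ⟨fun z hz => (heq z hz).1, fun z hz => (heq z hz).2⟩
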